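/- arXiv:math/0306286 — 3 statements merged into one kernel-verified Lean document; each statement's English description precedes it below -/
import Mathlib

section
/- Let α ≥ β > −1, let x_k be the largest zero of the Jacobi polynomial P_k^{(α,β)}, and define Δ(x) = p(x − A)(B − x)/(4(1 − x²)²), where p = r² + 2s + 1, s = α+β+1, q = α−β, r = 2k+α+β+1, R = √((r²−q²+2s+1)(r²−s²)), A = −(R + q(s+1))/p, and B = (R − q(s+1))/p. Then for every real x with x_k < x < B, one has Δ(x_k) − Δ(x) < R·(x − x_k)/(2(1 − x_k²)²). -/
/-- The Jacobi polynomial `P_k^{(α,β)}` as a real function: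
`P_k^{(α,β)}(x) = ∑_{i=0}^{k} [(∏_{j=1}^{k−i}(α+i+j))/(k−i)!] · [(∏_{j=1}^{i}(β+k−i+j))/i!]
  · ((x−1)/2)^i · ((x+1)/2)^{k−i}`. -/
noncomputable def jacobi (k : ℕ) (α β : ℝ) (x : ℝ) : ℝ :=
  ∑ i ∈ Finset.range (k + 1),
    ((∏ j ∈ Finset.range (k - i), (α + (i : ℝ) + (j : ℝ) + 1)) /
      (Nat.factorial (k - i))) *
    ((∏ j ∈ Finset.range i, (β + ((k - i : ℕ) : ℝ) + (j : ℝ) + 1)) /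
      (Nat.factorial i)) *
    ((x - 1) / 2) ^ i * ((x + 1) / 2) ^ (k - i)

/-- The coefficients of the Jacobi sum, cut off above `k`. -/
noncomputable def jcoef (k : ℕ) (α β : ℝ) (i : ℕ) : ℝ :=
  if i ≤ k then
    ((∏ j ∈ Finset.range (k - i), (α + (i : ℝ) + (j : ℝ) + 1)) /
      (Nat.factorial (k - i))) *
    ((∏ j ∈ Finset.range i, (β + ((k - i : ℕ) : ℝ) + (j : ℝ) + 1)) /
      (Nat.factorial i))
  else 0

lemma jcoef_rec (i m : ℕ) (α β : ℝ) :
    jcoef (i + m) α β (i + 1) * ((i + 1) * (α + i + 1))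
      = jcoef (i + m) α β i * (m * (m + β)) := by
  rcases m with _ | m
  · simp [jcoef]
  · have h1 : i + (m + 1) - i = m + 1 := by omega
    have h2 : i + (m + 1) - (i + 1) = m := by omega
    have h3 : i + 1 ≤ i + (m + 1) := by omega
    have h4 : i ≤ i + (m + 1) := by omega
    unfold jcoef
    rw [if_pos h3, if_pos h4, h1, h2]
    have e1 : (∏ j ∈ Finset.range (m + 1), (α + (i : ℝ) + (j : ℝ) + 1))
        = (∏ j ∈ Finset.range m, (α + ((i + 1 : ℕ) : ℝ) + (j : ℝ) + 1)) * (α + i + 1) := by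
      rw [Finset.prod_range_succ']
      congr 1
      · apply Finset.prod_congr rfl
        intro j _
        push_cast; ring
      · simp
    have e2 : (∏ j ∈ Finset.range (i + 1), (β + (m : ℝ) + (j : ℝ) + 1))
        = (∏ j ∈ Finset.range i, (β + ((m + 1 : ℕ) : ℝ) + (j : ℝ) + 1)) * (β + m + 1) := by
      rw [Finset.prod_range_succ']
      congr 1
      · apply Finset.prod_congr rfl
        intro j _
        push_cast; ring
      · simp
    rw [e1, e2, Nat.factorial_succ, Nat.factorial_succ]
    have f1 : (Nat.factorial m : ℝ) ≠ 0 := by positivity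
    have f2 : (Nat.factorial i : ℝ) ≠ 0 := by positivity
    have f3 : (m : ℝ) + 1 ≠ 0 := by positivity
    have f4 : (i : ℝ) + 1 ≠ 0 := by positivity
    push_cast
    field_simp
    ring

open Polynomial in
/-- The basic building block `((x-1)/2)^i ((x+1)/2)^m`. -/
noncomputable def jmon (i m : ℕ) : ℝ[X] :=
  (C (1/2) * (X - 1)) ^ i * (C (1/2) * (X + 1)) ^ m

open Polynomial in
/-- The Jacobi polynomial as a polynomial. -/
noncomputable def jpoly (k : ℕ) (α β : ℝ) : ℝ[X] :=
  ∑ i ∈ Finset.range (k + 1), C (jcoef k α β i) * jmon i (k - i)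

open Polynomial in
lemma jpoly_eval (k : ℕ) (α β x : ℝ) : (jpoly k α β).eval x = jacobi k α β x := by
  unfold jpoly jacobi
  rw [eval_finsetSum]
  apply Finset.sum_congr rfl
  intro i hi
  have : i ≤ k := by simp at hi; omega
  simp only [jmon, jcoef, if_pos this, eval_mul, eval_C, eval_pow, eval_sub, eval_add, eval_X,
    eval_one]
  rw [← mul_assoc, show (1/2 : ℝ) * (x - 1) = (x - 1)/2 by ring,
    show (1/2 : ℝ) * (x + 1) = (x + 1)/2 by ring]

/-- Telescoping function. -/
noncomputable def jtel (k : ℕ) (α β x : ℝ) (i : ℕ) : ℝ :=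
  jcoef k α β i * (i * (i + α)) *
    (((x - 1)/2) ^ (i - 1) * ((x + 1)/2) ^ (k + 1 - i) - ((x - 1)/2) ^ i * ((x + 1)/2) ^ (k - i))

open Polynomial in
lemma jmon_ode (i m : ℕ) (α β x : ℝ) :
    (1 - x ^ 2) * (derivative (derivative (jmon i m))).eval x
      + (β - α - (α + β + 2) * x) * (derivative (jmon i m)).eval x
      + ((i + m : ℝ) * (i + m + α + β + 1)) * (jmon i m).eval x
    = (i * (i + α)) * (((x - 1)/2) ^ i * ((x + 1)/2) ^ m
        - ((x - 1)/2) ^ (i - 1) * ((x + 1)/2) ^ (m + 1))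
      + (m * (m + β)) * (((x - 1)/2) ^ i * ((x + 1)/2) ^ m
        - ((x - 1)/2) ^ (i + 1) * ((x + 1)/2) ^ (m - 1)) := by
  unfold jmon
  rcases i with _ | _ | i <;> rcases m with _ | _ | m <;>
    simp [derivative_pow, derivative_mul] <;> ring

open Polynomial in
lemma jpoly_ode (k : ℕ) (α β x : ℝ) :
    (1 - x ^ 2) * (derivative (derivative (jpoly k α β))).eval x
      + (β - α - (α + β + 2) * x) * (derivative (jpoly k α β)).eval x
      + (k * (k + α + β + 1)) * (jpoly k α β).eval x = 0 := by
  have key : (1 - x ^ 2) * (derivative (derivative (jpoly k α β))).eval x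
      + (β - α - (α + β + 2) * x) * (derivative (jpoly k α β)).eval x
      + (k * (k + α + β + 1)) * (jpoly k α β).eval x
      = ∑ i ∈ Finset.range (k + 1), (jtel k α β x (i + 1) - jtel k α β x i) := by
    unfold jpoly
    simp only [derivative_sum, eval_finsetSum, Finset.mul_sum, ← Finset.sum_add_distrib,
      derivative_C_mul, eval_mul, eval_C]
    apply Finset.sum_congr rfl
    intro i hi
    obtain ⟨m, rfl⟩ : ∃ m, k = i + m := ⟨k - i, by simp at hi; omega⟩
    have h := jmon_ode i m α β x
    have hr := jcoef_rec i m α β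
    have e1 : i + m - i = m := by omega
    have e2 : i + m + 1 - i = m + 1 := by omega
    have e3 : i + m + 1 - (i + 1) = m := by omega
    have e4 : i + m - (i + 1) = m - 1 := by omega
    unfold jtel
    rw [e1, e2, e3, e4, Nat.add_sub_cancel]
    push_cast
    linear_combination jcoef (i + m) α β i * h -
      (((x - 1)/2) ^ i * ((x + 1)/2) ^ m - ((x - 1)/2) ^ (i + 1) * ((x + 1)/2) ^ (m - 1)) * hr
  rw [key, Finset.sum_range_sub]
  simp [jtel, jcoef]

lemma jacobi_one_pos (k : ℕ) (α β : ℝ) (hα : -1 < α) : 0 < jacobi k α β 1 := by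
  unfold jacobi
  rw [Finset.sum_eq_single 0]
  · simp only [Finset.prod_range_zero]
    have : 0 < ∏ j ∈ Finset.range (k - 0), (α + ((0 : ℕ) : ℝ) + (j : ℝ) + 1) := by
      apply Finset.prod_pos
      intro j _
      have : (0 : ℝ) ≤ j := by positivity
      push_cast
      linarith
    norm_num at this ⊢
    positivity
  · intro i _ hi
    simp [hi]
  · simp

open Polynomial in
/-- The largest zero lies to the right of the zero of the first Jacobi polynomial. -/
lemma largest_zero_ge (k : ℕ) (hk : 1 ≤ k) (α β : ℝ) (hα : -1 < α) (hβ : -1 < β)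
    (xk : ℝ) (hmax : ∀ y : ℝ, jacobi k α β y = 0 → y ≤ xk) :
    -(α - β) / (α + β + 2) ≤ xk := by
  set c := -(α - β) / (α + β + 2) with hc
  have hm : 0 < α + β + 2 := by linarith
  have hcm : (α + β + 2) * c = β - α := by rw [hc]; field_simp; ring
  have hc1 : c < 1 := by rw [hc, div_lt_one hm]; linarith
  have hc2 : -1 < c := by rw [hc, lt_div_iff₀ hm]; linarith
  by_contra! hlt
  set P := jpoly k α β with hP
  have ode : ∀ x : ℝ, (1 - x ^ 2) * (derivative (derivative P)).eval x
      - (α + β + 2) * (x - c) * (derivative P).eval x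
      + (k * (k + α + β + 1)) * P.eval x = 0 := by
    intro x
    have := jpoly_ode k α β x
    rw [← hP] at this
    linear_combination this + (derivative P).eval x * hcm
  have hne : ∀ y, c ≤ y → P.eval y ≠ 0 := by
    intro y hy h0
    rw [hP, jpoly_eval] at h0
    linarith [hmax y h0]
  have hP1 : 0 < P.eval 1 := by rw [hP, jpoly_eval]; exact jacobi_one_pos k α β hα
  have hpos : ∀ y ∈ Set.Icc c 1, 0 < P.eval y := by
    intro y hy
    by_contra! hle
    obtain ⟨z, hz, hz0⟩ := intermediate_value_Icc hy.2 (P.continuous.continuousOn)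
      (show (0 : ℝ) ∈ Set.Icc (P.eval y) (P.eval 1) from ⟨hle, hP1.le⟩)
    exact hne z (hy.1.trans hz.1) hz0
  have hk' : (1 : ℝ) ≤ k := by exact_mod_cast hk
  rcases eq_or_lt_of_le hk with h1 | h2
  · -- the case `k = 1`
    apply hne c le_rfl
    rw [hP, jpoly_eval, ← h1]
    simp [jacobi, Finset.sum_range_succ]
    linear_combination (1/2 : ℝ) * hcm
  have hk2 : (2 : ℝ) ≤ k := by exact_mod_cast h2
  have hlam : α + β + 2 < k * (k + α + β + 1) := by nlinarith
  set W : ℝ[X] := derivative P * (X - C c) - P with hW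
  have hWe : ∀ x, W.eval x = (derivative P).eval x * (x - c) - P.eval x := by
    intro x; simp [hW]
  have hWd : ∀ x, (derivative W).eval x = (derivative (derivative P)).eval x * (x - c) := by
    intro x; simp [hW]
  have hWc : W.eval c < 0 := by
    rw [hWe]; have := hpos c ⟨le_rfl, hc1.le⟩; simp; linarith
  have hW1 : 0 < W.eval 1 := by
    rw [hWe]
    have := ode 1
    have h3 : (α + β + 2) * ((derivative P).eval 1 * (1 - c) - P.eval 1)
      = (k * (k + α + β + 1) - (α + β + 2)) * P.eval 1 := by linear_combination -this
    have h4 : 0 < (k * (k + α + β + 1) - (α + β + 2)) * P.eval 1 :=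
      mul_pos (by linarith) hP1
    rw [← h3] at h4
    exact pos_of_mul_pos_right h4 hm.le
  -- last zero of W
  let S : Set ℝ := {z | z ∈ Set.Icc c 1 ∧ W.eval z = 0}
  have hScl : IsCompact S := by
    have : S = Set.Icc c 1 ∩ {z | W.eval z = 0} := rfl
    rw [this]
    exact isCompact_Icc.inter_right (isClosed_eq W.continuous continuous_const)
  have hSne : S.Nonempty := by
    obtain ⟨z, hz, hz0⟩ := intermediate_value_Icc hc1.le (W.continuous.continuousOn)
      (show (0 : ℝ) ∈ Set.Icc (W.eval c) (W.eval 1) from ⟨hWc.le, hW1.le⟩)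
    exact ⟨z, hz, hz0⟩
  obtain ⟨z, ⟨hzI, hz0⟩, hzmax⟩ := hScl.exists_isGreatest hSne
  have hzc : c < z := lt_of_le_of_ne hzI.1 (by rintro rfl; linarith)
  have hz1 : z < 1 := lt_of_le_of_ne hzI.2 (by rintro rfl; linarith)
  have hWpos : ∀ y, z < y → y ≤ 1 → 0 < W.eval y := by
    intro y hy hy1
    by_contra! hle
    obtain ⟨t, ht, ht0⟩ := intermediate_value_Icc hy1 (W.continuous.continuousOn)
      (show (0 : ℝ) ∈ Set.Icc (W.eval y) (W.eval 1) from ⟨hle, hW1.le⟩)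
    have := hzmax ⟨⟨(hzc.le.trans hy.le).trans ht.1, ht.2⟩, ht0⟩
    linarith [ht.1]
  have hPz := hpos z hzI
  have hd : (derivative W).eval z < 0 := by
    rw [hWd]
    apply mul_neg_of_neg_of_pos _ (by linarith)
    have h5 : (1 - z ^ 2) * (derivative (derivative P)).eval z
        = ((α + β + 2) - k * (k + α + β + 1)) * P.eval z := by
      rw [hWe] at hz0
      linear_combination ode z + (α + β + 2) * hz0
    have h6 : ((α + β + 2) - k * (k + α + β + 1)) * P.eval z < 0 :=
      mul_neg_of_neg_of_pos (by linarith) hPz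
    have h7 : 0 < 1 - z ^ 2 := by nlinarith
    rw [← h5] at h6
    by_contra! h8
    nlinarith [mul_nonneg h7.le h8]
  have hderiv := W.hasDerivAt z
  have hev := (hasDerivAt_iff_tendsto_slope.1 hderiv).mono_left
    (nhdsWithin_mono z (show Set.Ioi z ⊆ {z}ᶜ from fun t ht => ne_of_gt ht))
  have hge : 0 ≤ (derivative W).eval z := by
    apply ge_of_tendsto hev
    filter_upwards [Ioc_mem_nhdsGT hz1] with y hy
    rw [slope_def_field]
    apply div_nonneg
    · have := hWpos y hy.1 hy.2
      rw [hz0]; linarith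
    · linarith [hy.1]
  linarith

/-- The purely algebraic inequality. -/
lemma alg_ineq (A B x y : ℝ) (hA : -1 < A) (hB : B < 1) (hAy : A < y) (hyx : y < x) (hxB : x < B) :
    (y - A) * (B - y) / (1 - y ^ 2) ^ 2 - (x - A) * (B - x) / (1 - x ^ 2) ^ 2
      < (B - A) * (x - y) / (1 - y ^ 2) ^ 2 := by
  have hDx : 0 < 1 - x ^ 2 := by nlinarith
  have hDy : 0 < 1 - y ^ 2 := by nlinarith
  have hxA : 0 < x - A := by linarith
  have hBx : 0 < B - x := by linarith
  have hxy : 0 < x - y := by linarith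
  rw [sub_lt_iff_lt_add, ← sub_lt_iff_lt_add', ← sub_div, div_lt_div_iff₀ (by positivity)
    (by positivity)]
  have main : (y - A) * (B - y) * (1 - x ^ 2) ^ 2 - (B - A) * (x - y) * (1 - x ^ 2) ^ 2
      < (x - A) * (B - x) * (1 - y ^ 2) ^ 2 := by
    rcases le_total 0 (x + y) with he | he
    · have h1 : (1 - x ^ 2) ^ 2 ≤ (1 - y ^ 2) ^ 2 := by
        apply pow_le_pow_left₀ hDx.le
        nlinarith
      have h2 : (y - A) * (B - y) - (B - A) * (x - y) < (x - A) * (B - x) := by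
        nlinarith [mul_pos hxy (show 0 < 2 * B - x - y by linarith)]
      calc _ = ((y - A) * (B - y) - (B - A) * (x - y)) * (1 - x ^ 2) ^ 2 := by ring
        _ < ((x - A) * (B - x)) * (1 - x ^ 2) ^ 2 :=
          mul_lt_mul_of_pos_right h2 (by positivity)
        _ ≤ _ := mul_le_mul_of_nonneg_left h1 (by positivity)
    · -- `(y - A)(1 - x²) ≤ (x - A)(1 - y²)`
      have hxyp : 0 < 1 + x * y - A * (x + y) := by
        have : 0 < (x - A) * (y - A) := mul_pos hxA (by linarith)
        nlinarith
      have h1 : (y - A) * (1 - x ^ 2) ≤ (x - A) * (1 - y ^ 2) := by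
        nlinarith [mul_pos hxy hxyp]
      have h3 : (x - A) * (-(x + y)) ≤ 1 - x ^ 2 := by nlinarith
      have h4 : 1 - y ^ 2 ≤ 1 - x ^ 2 := by nlinarith
      have h5 : (x - A) * (-(x + y)) * (1 - y ^ 2) ≤ (1 - x ^ 2) * (1 - x ^ 2) :=
        mul_le_mul h3 h4 hDy.le hDx.le
      have h6 : (x - A) * (1 - x ^ 2 + (-(x + y)) * (B - x)) * (1 - y ^ 2)
          ≤ (B - A) * (1 - x ^ 2) ^ 2 := by
        have a1 := mul_le_mul_of_nonneg_left h5 hBx.le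
        have a2 := mul_le_mul_of_nonneg_left h4 (mul_pos hxA hDx).le
        nlinarith
      have h7 : (y - A) * (1 - x ^ 2) * ((B - y) * (1 - x ^ 2))
          ≤ (x - A) * (1 - y ^ 2) * ((B - y) * (1 - x ^ 2)) :=
        mul_le_mul_of_nonneg_right h1 (mul_pos (by linarith) hDx).le
      have h8 := mul_le_mul_of_nonneg_left h6 hxy.le
      have h1s : (y - A) * (1 - x ^ 2) < (x - A) * (1 - y ^ 2) := by
        nlinarith [mul_pos hxy hxyp]
      have h7s : (y - A) * (1 - x ^ 2) * ((B - y) * (1 - x ^ 2))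
          < (x - A) * (1 - y ^ 2) * ((B - y) * (1 - x ^ 2)) :=
        mul_lt_mul_of_pos_right h1s (mul_pos (by linarith) hDx)
      linear_combination h7s + h8
  linear_combination main

/-- Discriminant difference bound at the largest Jacobi zero: for `x_k < x < B`,
`Δ(x_k) − Δ(x) < R (x − x_k)/(2(1 − x_k²)²)`, where
`Δ(x) = p (x − A)(B − x)/(4(1 − x²)²)` and `p = r² + 2s + 1`. -/
theorem jacobi_discriminant_diff_largest
    (k : ℕ) (hk : 1 ≤ k) (α β : ℝ) (hβ : -1 < β) (hαβ : β ≤ α)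
    (s q r R : ℝ)
    (hs : s = α + β + 1) (hq : q = α - β) (hr : r = 2 * (k : ℝ) + α + β + 1)
    (hR : R = Real.sqrt ((r ^ 2 - q ^ 2 + 2 * s + 1) * (r ^ 2 - s ^ 2)))
    (p : ℝ) (hp : p = r ^ 2 + 2 * s + 1)
    (A : ℝ) (hA : A = -(R + q * (s + 1)) / p)
    (B : ℝ) (hB : B = (R - q * (s + 1)) / p)
    (Δ : ℝ → ℝ) (hΔ : ∀ y : ℝ, Δ y = p * (y - A) * (B - y) / (4 * (1 - y ^ 2) ^ 2))
    (xk : ℝ) (hroot : jacobi k α β xk = 0)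
    (hmax : ∀ y : ℝ, jacobi k α β y = 0 → y ≤ xk) :
    ∀ x : ℝ, xk < x → x < B →
      Δ xk - Δ x < R * (x - xk) / (2 * (1 - xk ^ 2) ^ 2) := by
  intro x hx hxB
  have hα : -1 < α := by linarith
  have hk' : (1 : ℝ) ≤ k := by exact_mod_cast hk
  have hc := largest_zero_ge k hk α β hα hβ xk hmax
  set c := -(α - β) / (α + β + 2) with hcdef
  have hm : 0 < α + β + 2 := by linarith
  have hcm : (s + 1) * c = -q := by rw [hcdef, hs, hq]; field_simp; ring
  have hc1 : c < 1 := by rw [hcdef, div_lt_one hm]; linarith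
  have hc2 : -1 < c := by rw [hcdef, lt_div_iff₀ hm]; linarith
  have hd : 0 < r ^ 2 - s ^ 2 := by
    have : r ^ 2 - s ^ 2 = 4 * k * (k + s) := by rw [hr, hs]; ring
    rw [this]
    have : 0 < k + s := by rw [hs]; linarith
    positivity
  have hpp : 0 < p := by rw [hp]; nlinarith [sq_nonneg (s + 1)]
  have hmq : 0 < (s + 1) ^ 2 - q ^ 2 := by
    have : (s + 1) ^ 2 - q ^ 2 = 4 * (α + 1) * (β + 1) := by rw [hs, hq]; ring
    rw [this]
    have h1 : 0 < α + 1 := by linarith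
    have h2 : 0 < β + 1 := by linarith
    positivity
  have hR0 : 0 ≤ R := by rw [hR]; exact Real.sqrt_nonneg _
  have hR2 : R ^ 2 = (r ^ 2 - q ^ 2 + 2 * s + 1) * (r ^ 2 - s ^ 2) := by
    rw [hR, Real.sq_sqrt]
    apply mul_nonneg _ hd.le
    nlinarith
  have hpA : p * A = -(R + q * (s + 1)) := by rw [hA]; field_simp
  have hpB : p * B = R - q * (s + 1) := by rw [hB]; field_simp
  have hN : ∀ t : ℝ, p * (t - A) * (B - t)
      = (r ^ 2 - s ^ 2) * (1 - t ^ 2) - (q + (s + 1) * t) ^ 2 := by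
    intro t
    apply mul_left_cancel₀ hpp.ne'
    have : p * (p * (t - A) * (B - t)) = (p * t - p * A) * (p * B - p * t) := by ring
    rw [this, hpA, hpB]
    have : (p * t - -(R + q * (s + 1))) * (R - q * (s + 1) - p * t)
      = R ^ 2 - (p * t + q * (s + 1)) ^ 2 := by ring
    rw [this, hR2, hp]
    ring
  have hAB : A ≤ B := by
    apply le_of_mul_le_mul_left _ hpp
    rw [hpA, hpB]
    linarith
  have hNc : 0 < p * (c - A) * (B - c) := by
    rw [hN, hcm]
    have : 0 < 1 - c ^ 2 := by nlinarith
    have := mul_pos hd this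
    linarith [show (q + -q) ^ 2 = 0 by ring]
  have hNm : p * (-1 - A) * (B - -1) < 0 := by
    rw [hN]
    have : 0 < s + 1 - q := by rw [hs, hq]; linarith
    nlinarith [mul_pos this this]
  have hN1 : p * (1 - A) * (B - 1) < 0 := by
    rw [hN]
    have : 0 < s + 1 + q := by rw [hs, hq]; linarith
    nlinarith [mul_pos this this]
  have hAc : A < c := by
    by_contra! h
    have := mul_nonneg (mul_nonneg hpp.le (sub_nonneg.2 h)) (sub_nonneg.2 (h.trans hAB))
    have e : p * (c - A) * (B - c) = -(p * (A - c) * (B - c)) := by ring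
    linarith
  have hcB : c < B := by linarith
  have hA1 : -1 < A := by
    by_contra! h
    have := mul_nonneg (mul_nonneg hpp.le (show 0 ≤ -1 - A by linarith))
      (show 0 ≤ B - -1 by linarith)
    linarith
  have hB1 : B < 1 := by
    by_contra! h
    have := mul_nonneg (mul_nonneg hpp.le (show 0 ≤ 1 - A by linarith))
      (show 0 ≤ B - 1 by linarith)
    linarith
  have hmain := alg_ineq A B x xk hA1 hB1 (by linarith) hx hxB
  have hfin := mul_lt_mul_of_pos_left hmain (show 0 < p / 4 by positivity)
  have hRR : 2 * R = p * (B - A) := by linear_combination hpA - hpB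
  rw [hΔ, hΔ]
  have e1 : R * (x - xk) / (2 * (1 - xk ^ 2) ^ 2)
      = p / 4 * ((B - A) * (x - xk) / (1 - xk ^ 2) ^ 2) := by
    have : R = p * (B - A) / 2 := by linarith
    rw [this]
    generalize (1 - xk ^ 2) ^ 2 = D
    rw [div_eq_mul_inv, div_eq_mul_inv _ D, mul_inv]
    ring
  rw [e1]
  refine lt_of_eq_of_lt ?_ hfin
  generalize (1 - xk ^ 2) ^ 2 = D
  generalize (1 - x ^ 2) ^ 2 = E
  rw [div_eq_mul_inv, div_eq_mul_inv _ (4 * E), div_eq_mul_inv _ D, div_eq_mul_inv _ E,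
    mul_inv, mul_inv]
  ring
end

section
/- There exist absolute constants C > 0 and K such that for every integer k ≥ K and every real α > 50, the least zero x_1 of the generalized Laguerre polynomial L_k^{(α)} satisfies 0 < x_1/V² − 1 ≤ C·(α+1)^{−1/2}·(1/(α+1) + 1/k)^{1/6}, where V = √(k+α+1) − √k. -/
/-- The generalized Laguerre polynomial `L_k^{(α)}` as a real function:
`L_k^{(α)}(x) = ∑_{i=0}^{k} ((−1)^i / i!) · (∏_{j=1}^{k−i} (α + i + j))/(k−i)! · x^i`. -/
noncomputable def laguerre (k : ℕ) (α : ℝ) (x : ℝ) : ℝ :=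
  ∑ i ∈ Finset.range (k + 1),
    ((-1 : ℝ) ^ i / (Nat.factorial i)) *
      ((∏ j ∈ Finset.range (k - i), (α + (i : ℝ) + (j : ℝ) + 1)) /
        (Nat.factorial (k - i))) * x ^ i

open Polynomial in
/-- The Laguerre polynomial satisfies its differential equation. -/
lemma laguerre_poly_exists (k : ℕ) (α : ℝ) (hα : 50 < α) :
    ∃ p : Polynomial ℝ, (∀ x, p.eval x = laguerre k α x) ∧
      ∀ x : ℝ, x * p.derivative.derivative.eval x + (α + 1 - x) * p.derivative.eval x
        + k * p.eval x = 0 := by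
  set c : ℕ → ℝ := fun i => ((-1 : ℝ) ^ i / (Nat.factorial i)) *
      ((∏ j ∈ Finset.range (k - i), (α + (i : ℝ) + (j : ℝ) + 1)) /
        (Nat.factorial (k - i))) with hc
  have hrec : ∀ i, i < k → ((i : ℝ) + 1) * (α + 1 + i) * c (i + 1) = -((k : ℝ) - i) * c i := by
    intro i hi
    obtain ⟨m, rfl⟩ : ∃ m, k = i + 1 + m := ⟨k - (i + 1), by omega⟩
    have h1 : i + 1 + m - i = m + 1 := by omega
    have h2 : i + 1 + m - (i + 1) = m := by omega
    simp only [hc, h1, h2]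
    rw [Finset.prod_range_succ', Nat.factorial_succ, Nat.factorial_succ]
    have h3 : ∏ j ∈ Finset.range m, (α + (i : ℝ) + ((j + 1 : ℕ) : ℝ) + 1)
        = ∏ j ∈ Finset.range m, (α + ((i + 1 : ℕ) : ℝ) + (j : ℝ) + 1) := by
      apply Finset.prod_congr rfl
      intro j _
      push_cast
      ring
    rw [h3]
    have hm : (m.factorial : ℝ) ≠ 0 := by positivity
    have hi' : (i.factorial : ℝ) ≠ 0 := by positivity
    have hm1 : (m : ℝ) + 1 ≠ 0 := by positivity
    have hi1 : (i : ℝ) + 1 ≠ 0 := by positivity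
    push_cast
    generalize ∏ j ∈ Finset.range m, (α + ((i : ℝ) + 1) + (j : ℝ) + 1) = Q
    field_simp
    ring
  set p : Polynomial ℝ := ∑ i ∈ Finset.range (k + 1), C (c i) * X ^ i with hp
  have hcoeff : ∀ n, p.coeff n = if n < k + 1 then c n else 0 := by
    intro n
    simp [hp, Polynomial.finset_sum_coeff, Polynomial.coeff_C_mul, Polynomial.coeff_X_pow]
  have hode : X * derivative (derivative p) + (C (α + 1) - X) * derivative p + C (k : ℝ) * p
      = 0 := by
    ext n
    rw [sub_mul]
    simp only [coeff_add, coeff_sub, coeff_C_mul, coeff_zero]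
    have key : ((n : ℝ) + 1) * (α + 1 + n) * p.coeff (n + 1) + ((k : ℝ) - n) * p.coeff n = 0 := by
      rw [hcoeff, hcoeff]
      rcases lt_trichotomy n k with h | h | h
      · rw [if_pos (by omega), if_pos (by omega), hrec n h]
        ring
      · rw [if_neg (by omega), h]
        ring
      · rw [if_neg (by omega), if_neg (by omega)]
        ring
    cases n with
    | zero =>
      simp only [coeff_X_mul_zero, coeff_derivative]
      push_cast at key ⊢
      linarith
    | succ n =>
      simp only [coeff_X_mul, coeff_derivative]
      push_cast at key ⊢
      linarith
  refine ⟨p, ?_, ?_⟩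
  · intro x
    simp [hp, laguerre, hc, Polynomial.eval_finset_sum]
  · intro x
    have := congrArg (Polynomial.eval x) hode
    simpa using this

lemma laguerre_pos_of_nonpos (k : ℕ) (α : ℝ) (hα : 50 < α) (y : ℝ) (hy : y ≤ 0) :
    0 < laguerre k α y := by
  unfold laguerre
  have hpos : ∀ i : ℕ, 0 < (∏ j ∈ Finset.range (k - i), (α + (i : ℝ) + (j : ℝ) + 1)) /
        (Nat.factorial (k - i)) := by
    intro i
    apply div_pos
    · apply Finset.prod_pos
      intro j _
      positivity
    · positivity
  have hterm : ∀ i : ℕ, ((-1 : ℝ) ^ i / (Nat.factorial i)) *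
      ((∏ j ∈ Finset.range (k - i), (α + (i : ℝ) + (j : ℝ) + 1)) /
        (Nat.factorial (k - i))) * y ^ i = (-y) ^ i / (Nat.factorial i) *
      ((∏ j ∈ Finset.range (k - i), (α + (i : ℝ) + (j : ℝ) + 1)) /
        (Nat.factorial (k - i))) := by
    intro i
    rw [neg_pow y i]
    ring
  apply Finset.sum_pos'
  · intro i _
    rw [hterm]
    have h1 : 0 ≤ (-y) ^ i := pow_nonneg (by linarith) i
    have := hpos i
    positivity
  · refine ⟨0, by simp, ?_⟩
    rw [hterm]
    have := hpos 0
    simp only [pow_zero, Nat.factorial_zero, Nat.cast_one, div_one, one_mul]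
    exact this

/-- Integrating-factor positivity. -/
lemma pos_of_first_order (b X : ℝ) (hb : 0 < b) (g g' : ℝ → ℝ)
    (hg : ∀ x, HasDerivAt g (g' x) x)
    (hr : ∀ x, 0 < x → x < X → 0 < x * g' x + (b - x) * g x) :
    ∀ x, 0 < x → x ≤ X → 0 < g x := by
  intro x hx hxX
  have hmono : StrictMonoOn (fun t : ℝ => t ^ b * Real.exp (-t) * g t) (Set.Icc 0 X) := by
    apply strictMonoOn_of_deriv_pos (convex_Icc 0 X)
    · apply Continuous.continuousOn
      have h1 : Continuous fun t : ℝ => t ^ b := Real.continuous_rpow_const hb.le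
      have h2 : Continuous g := continuous_iff_continuousAt.2 fun t => (hg t).continuousAt
      fun_prop
    · intro t ht
      rw [interior_Icc] at ht
      have h1 : HasDerivAt (fun t : ℝ => t ^ b) (b * t ^ (b - 1)) t :=
        Real.hasDerivAt_rpow_const (Or.inl ht.1.ne')
      have h2 : HasDerivAt (fun t : ℝ => Real.exp (-t)) (Real.exp (-t) * (-1)) t :=
        (hasDerivAt_neg t).exp
      have h3 := (h1.mul h2).mul (hg t)
      have h4 := h3.deriv
      have h5 : t ^ b = t ^ (b - 1) * t := by
        rw [← Real.rpow_add_one ht.1.ne']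
        congr 1
        ring
      have h6 : deriv (fun t : ℝ => t ^ b * Real.exp (-t) * g t) t =
          t ^ (b - 1) * Real.exp (-t) * (t * g' t + (b - t) * g t) := by
        refine Eq.trans h4 ?_
        simp only [Pi.mul_apply]
        rw [h5]
        ring
      rw [h6]
      have := hr t ht.1 ht.2
      have h7 : 0 < t ^ (b - 1) := Real.rpow_pos_of_pos ht.1 _
      positivity
  have h := hmono (Set.left_mem_Icc.2 (hx.le.trans hxX)) ⟨hx.le, hxX⟩ hx
  simp only [Real.zero_rpow hb.ne', zero_mul] at h
  have h7 : 0 < x ^ b * Real.exp (-x) := mul_pos (Real.rpow_pos_of_pos hx _) (Real.exp_pos _)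
  exact (mul_pos_iff_of_pos_left h7).1 h

/-- Lower bound core. -/
lemma disc_neg_of_zero (k : ℕ) (hk : 0 < k) (a x1 : ℝ) (ha : 0 < a) (hx1 : 0 < x1)
    (p : Polynomial ℝ)
    (hode : ∀ x : ℝ, x * p.derivative.derivative.eval x + (a - x) * p.derivative.eval x
        + k * p.eval x = 0)
    (hpos : ∀ x, x < x1 → 0 < p.eval x) (hzero : p.eval x1 = 0) :
    ∃ x, 0 < x ∧ x < x1 ∧ (a - x) ^ 2 - 4 * k * x < 0 := by
  have hk' : (0 : ℝ) < k := by exact_mod_cast hk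
  have hd1 : ∀ x, 0 < x → x ≤ x1 → 0 < - p.derivative.eval x := by
    apply pos_of_first_order a x1 ha _ (fun x => - p.derivative.derivative.eval x)
    · intro x
      exact (p.derivative.hasDerivAt x).neg
    · intro x hx hxX
      have h1 := hode x
      have h2 := mul_pos hk' (hpos x hxX)
      linarith
  have hW : ∀ x, 0 < x → x ≤ x1 → 0 < (p.derivative * p.derivative -
      p * p.derivative.derivative).eval x := by
    apply pos_of_first_order (a + 1) x1 (by linarith) _ (fun x =>
      (Polynomial.derivative (p.derivative * p.derivative -
      p * p.derivative.derivative)).eval x)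
    · intro x
      exact Polynomial.hasDerivAt _ x
    · intro x hx hxX
      have h0 := hode x
      have hode2 : x * p.derivative.derivative.derivative.eval x
          + (a + 1 - x) * p.derivative.derivative.eval x
          + (k - 1) * p.derivative.eval x = 0 := by
        have e : HasDerivAt (fun x : ℝ => x * p.derivative.derivative.eval x
            + (a - x) * p.derivative.eval x + k * p.eval x)
            ((1 * p.derivative.derivative.eval x
              + x * p.derivative.derivative.derivative.eval x)
             + ((-1) * p.derivative.eval x + (a - x) * p.derivative.derivative.eval x)
             + k * p.derivative.eval x) x := by
          have d2 := p.derivative.derivative.hasDerivAt x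
          have d1 := p.derivative.hasDerivAt x
          have d0 := p.hasDerivAt x
          exact (((hasDerivAt_id x).mul d2).add
            (((hasDerivAt_id x).const_sub a).mul d1)).add (d0.const_mul (k : ℝ))
        have e2 : (fun x : ℝ => x * p.derivative.derivative.eval x
            + (a - x) * p.derivative.eval x + k * p.eval x) = fun _ => 0 := funext hode
        rw [e2] at e
        have := e.unique (hasDerivAt_const x (0 : ℝ))
        linarith
      have hf := hpos x hxX
      have hf' := hd1 x hx hxX.le
      simp only [Polynomial.derivative_sub, Polynomial.derivative_mul, Polynomial.eval_sub,
        Polynomial.eval_mul, Polynomial.eval_add]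
      generalize p.derivative.derivative.derivative.eval x = f3 at *
      generalize p.derivative.derivative.eval x = f2 at *
      generalize p.derivative.eval x = f1 at *
      generalize p.eval x = f at *
      have key : x * (f2 * f1 + f1 * f2 - (f1 * f2 + f * f3)) +
          (a + 1 - x) * (f1 * f1 - f * f2) = (-f1) * (f - f1) := by
        linear_combination f1 * h0 - f * hode2
      rw [key]
      apply mul_pos hf'
      linarith
  -- intermediate value theorem
  have hcont : ContinuousOn (fun x => 2 * x * p.derivative.eval x + (a - x) * p.eval x)
      (Set.Icc 0 x1) := by
    apply Continuous.continuousOn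
    fun_prop
  have hivt := intermediate_value_Icc' hx1.le hcont
  have hmem : (0 : ℝ) ∈ Set.Icc (2 * x1 * p.derivative.eval x1 + (a - x1) * p.eval x1)
      (2 * 0 * p.derivative.eval 0 + (a - 0) * p.eval 0) := by
    constructor
    · rw [hzero]
      have := mul_pos hx1 (hd1 x1 hx1 le_rfl)
      linarith
    · have := mul_pos ha (hpos 0 hx1)
      linarith
  obtain ⟨x, hxm, hx0⟩ := hivt hmem
  simp only at hx0
  have hxpos : 0 < x := by
    rcases hxm.1.lt_or_eq with h | h
    · exact h
    · exfalso
      rw [← h] at hx0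
      have := mul_pos ha (hpos 0 hx1)
      linarith
  have hxlt : x < x1 := by
    rcases hxm.2.lt_or_eq with h | h
    · exact h
    · exfalso
      rw [h, hzero] at hx0
      have := mul_pos hx1 (hd1 x1 hx1 le_rfl)
      linarith
  refine ⟨x, hxpos, hxlt, ?_⟩
  have hw := hW x hxpos hxlt.le
  have h0 := hode x
  have hf := hpos x hxlt
  simp only [Polynomial.eval_sub, Polynomial.eval_mul] at hw
  generalize p.derivative.derivative.eval x = f2 at *
  generalize p.derivative.eval x = f1 at *
  generalize p.eval x = f at *
  have key : 4 * x * x * (f1 * f1 - f * f2) = -((a - x) ^ 2 - 4 * k * x) * f ^ 2 := by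
    linear_combination (-4 * x * f) * h0 + (2 * x * f1 + (a - x) * f) * hx0
  have h1 : 0 < 4 * x * x * (f1 * f1 - f * f2) := by positivity
  rw [key] at h1
  have h2 : 0 < f ^ 2 := by positivity
  have := (mul_pos_iff_of_pos_right h2).1 h1
  linarith

/-- Riccati blow-up: a nonvanishing solution cannot exist on a long interval. -/
lemma riccati_bound (k : ℕ) (a y z q : ℝ) (ha : 0 < a) (hy : 0 < y) (hyz : y < z) (hq : 0 < q)
    (p : Polynomial ℝ)
    (hode : ∀ x : ℝ, x * p.derivative.derivative.eval x + (a - x) * p.derivative.eval x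
        + k * p.eval x = 0)
    (hne : ∀ x ∈ Set.Icc y z, p.eval x ≠ 0)
    (hQ : ∀ x ∈ Set.Icc y z, q ^ 2 * (4 * x ^ 2) ≤ 4 * k * x - (a - x) ^ 2) :
    q * (z - y) < Real.pi := by
  set s : ℝ → ℝ := fun x => p.derivative.eval x / p.eval x + (a - x) / (2 * x) with hs
  have hder : ∀ x ∈ Set.Icc y z, HasDerivAt s
      (((p.derivative.derivative.eval x * p.eval x - p.derivative.eval x * p.derivative.eval x)
        / p.eval x ^ 2) + ((-1) * (2 * x) - (a - x) * (2 * 1)) / (2 * x) ^ 2) x := by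
    intro x hx
    have hx0 : 0 < x := lt_of_lt_of_le hy hx.1
    exact ((p.derivative.hasDerivAt x).div (p.hasDerivAt x) (hne x hx)).add
      (((hasDerivAt_id x).const_sub a).div ((hasDerivAt_id x).const_mul 2) (by positivity))
  have hderle : ∀ x ∈ Set.Icc y z,
      (((p.derivative.derivative.eval x * p.eval x - p.derivative.eval x * p.derivative.eval x)
        / p.eval x ^ 2) + ((-1) * (2 * x) - (a - x) * (2 * 1)) / (2 * x) ^ 2) ≤
        -(q ^ 2 + s x ^ 2) := by
    intro x hx
    have hx0 : 0 < x := lt_of_lt_of_le hy hx.1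
    have h0 := hode x
    have hf := hne x hx
    have hQx := hQ x hx
    simp only [hs]
    generalize p.derivative.derivative.eval x = f2 at *
    generalize p.derivative.eval x = f1 at *
    generalize p.eval x = f at *
    have hf2 : f2 = -((a - x) * f1 + k * f) / x := by
      field_simp
      linarith
    have key : (f2 * f - f1 * f1) / f ^ 2 + ((-1) * (2 * x) - (a - x) * (2 * 1)) / (2 * x) ^ 2
        = -(((4 * k * x - (a - x) ^ 2) + 2 * a) / (4 * x ^ 2) + (f1 / f + (a - x) / (2 * x)) ^ 2)
        := by
      rw [hf2]
      field_simp
      ring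
    rw [key]
    have h1 : q ^ 2 ≤ ((4 * k * x - (a - x) ^ 2) + 2 * a) / (4 * x ^ 2) := by
      rw [le_div_iff₀ (by positivity)]
      linarith
    linarith
  have hat : ∀ x ∈ Set.Icc y z, HasDerivAt (fun x => Real.arctan (s x / q))
      (1 / (1 + (s x / q) ^ 2) *
      ((((p.derivative.derivative.eval x * p.eval x - p.derivative.eval x * p.derivative.eval x)
        / p.eval x ^ 2) + ((-1) * (2 * x) - (a - x) * (2 * 1)) / (2 * x) ^ 2) / q)) x := by
    intro x hx
    exact ((hder x hx).div_const q).arctan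
  obtain ⟨c, hc, hceq⟩ := exists_hasDerivAt_eq_slope (fun x => Real.arctan (s x / q)) _ hyz
    (fun x hx => (hat x hx).continuousAt.continuousWithinAt)
    (fun x hx => hat x (Set.Ioo_subset_Icc_self hx))
  have hcm := Set.Ioo_subset_Icc_self hc
  have hle := hderle c hcm
  have h1 : (1 / (1 + (s c / q) ^ 2) *
      ((((p.derivative.derivative.eval c * p.eval c - p.derivative.eval c * p.derivative.eval c)
        / p.eval c ^ 2) + ((-1) * (2 * c) - (a - c) * (2 * 1)) / (2 * c) ^ 2) / q)) ≤ -q := by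
    have e : -q = 1 / (1 + (s c / q) ^ 2) * (-(q ^ 2 + s c ^ 2) / q) := by
      have : q ^ 2 + s c ^ 2 ≠ 0 := by positivity
      field_simp
    rw [e]
    gcongr
  rw [hceq, div_le_iff₀ (by linarith)] at h1
  have h2 := Real.arctan_lt_pi_div_two (s y / q)
  have h3 := Real.neg_pi_div_two_lt_arctan (s z / q)
  linarith

lemma laguerre_upper_num (k a V E : ℝ) (hk : 100000 ≤ k) (ha : 51 < a)
    (hV : V = Real.sqrt (k + a) - Real.sqrt k) (hE0 : 0 < E)
    (hE : E ^ 6 = (k + a) / (k * a ^ 4)) :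
    ∃ q : ℝ, 0 < q ∧ Real.pi ≤ q * (V ^ 2 * (1 + 1000 * E) - V ^ 2 * (1 + 500 * E)) ∧
      ∀ x ∈ Set.Icc (V ^ 2 * (1 + 500 * E)) (V ^ 2 * (1 + 1000 * E)),
        q ^ 2 * (4 * x ^ 2) ≤ 4 * k * x - (a - x) ^ 2 := by
  have hk0 : 0 < k := by linarith
  have ha0 : 0 < a := by linarith
  set A := Real.sqrt (k + a) with hA
  set B := Real.sqrt k with hB
  have hA2 : A ^ 2 = k + a := Real.sq_sqrt (by linarith)
  have hB2 : B ^ 2 = k := Real.sq_sqrt hk0.le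
  have hB0 : 0 < B := Real.sqrt_pos.2 hk0
  have hA0 : 0 < A := Real.sqrt_pos.2 (by linarith)
  have hAB : B < A := Real.sqrt_lt_sqrt hk0.le (by linarith)
  have hV0 : 0 < V := by rw [hV]; linarith
  have hVa : V * (A + B) = a := by rw [hV]; linarith [hA2, hB2]
  -- E ^ 3 = A / (B a^2)
  have hE3 : E ^ 3 * (B * a ^ 2) = A := by
    have h1 : (E ^ 3 * (B * a ^ 2)) ^ 2 = A ^ 2 := by
      have : (E ^ 3 * (B * a ^ 2)) ^ 2 = E ^ 6 * (B ^ 2 * a ^ 4) := by ring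
      rw [this, hE, hB2, hA2]
      field_simp
    exact (pow_left_inj₀ (by positivity) hA0.le two_ne_zero).1 h1
  -- lower bound for E^3 A B V^2
  have hVlow : a ≤ V * (2 * A) := by
    rw [← hVa]; gcongr; linarith
  have hVup : V * A ≤ a := by
    rw [← hVa]; gcongr; linarith
  have hmain : 1 / 4 ≤ E ^ 3 * (A * B) * V ^ 2 := by
    have h1 : E ^ 3 * (A * B) * V ^ 2 * a ^ 2 = (V * A) ^ 2 := by
      linear_combination (A * V ^ 2) * hE3
    have h2 : a ^ 2 ≤ 4 * (V * A) ^ 2 := by nlinarith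
    have h3 : 1 / 4 * a ^ 2 ≤ E ^ 3 * (A * B) * V ^ 2 * a ^ 2 := by rw [h1]; linarith
    exact le_of_mul_le_mul_right h3 (by positivity)
  -- E ≤ 1
  have hE1 : E ≤ 1 := by
    by_contra h
    push Not at h
    have h1 : 1 < E ^ 6 := one_lt_pow₀ h (by norm_num)
    rw [hE, lt_div_iff₀ (by positivity)] at h1
    have h2 : a ^ 4 ≥ a + 1 := by nlinarith [sq_nonneg (a^2 - 1), sq_nonneg a]
    nlinarith
  -- V^2 * (1000 E) ≤ 2 A B
  have hsmall : V ^ 2 * (1000 * E) ≤ 2 * (A * B) := by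
    have h1 : (V ^ 2 * (500 * E)) ^ 3 ≤ (A * B) ^ 3 := by
      have e1 : (V ^ 2 * (500 * E)) ^ 3 * (A ^ 5 * B * a ^ 2) =
          500 ^ 3 * (V * A) ^ 6 := by
        linear_combination (500 ^ 3 * V ^ 6 * A ^ 5) * hE3
      have e2 : (V * A) ^ 6 ≤ a ^ 6 := by gcongr
      have e3 : a ^ 6 ≤ a ^ 2 * A ^ 8 := by
        have : A ^ 8 = (k + a) ^ 4 := by rw [← hA2]; ring
        rw [this]
        have : a ^ 4 ≤ (k + a) ^ 4 := by gcongr; linarith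
        nlinarith [sq_nonneg a]
      have e4 : (500 : ℝ) ^ 3 ≤ B ^ 4 := by
        have : B ^ 4 = k ^ 2 := by rw [← hB2]; ring
        rw [this]
        nlinarith
      have e5 : (V ^ 2 * (500 * E)) ^ 3 * (A ^ 5 * B * a ^ 2) ≤
          (A * B) ^ 3 * (A ^ 5 * B * a ^ 2) := by
        rw [e1]
        calc 500 ^ 3 * (V * A) ^ 6 ≤ B ^ 4 * (a ^ 2 * A ^ 8) := by
              gcongr
              exact e2.trans e3
          _ = _ := by ring
      exact le_of_mul_le_mul_right e5 (by positivity)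
    have h2 := (pow_le_pow_iff_left₀ (by positivity) (by positivity) (three_ne_zero)).1 h1
    linarith
  set q := Real.sqrt (250 * E * (A * B) / (1001 ^ 2 * V ^ 2)) with hq
  have harg : 0 < 250 * E * (A * B) / (1001 ^ 2 * V ^ 2) := by positivity
  have hq2 : q ^ 2 = 250 * E * (A * B) / (1001 ^ 2 * V ^ 2) := Real.sq_sqrt harg.le
  have hq0 : 0 < q := Real.sqrt_pos.2 harg
  refine ⟨q, hq0, ?_, ?_⟩
  · have h1 : (q * (V ^ 2 * (1 + 1000 * E) - V ^ 2 * (1 + 500 * E))) ^ 2 =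
        250 * 500 ^ 2 / 1001 ^ 2 * (E ^ 3 * (A * B) * V ^ 2) := by
      have : (q * (V ^ 2 * (1 + 1000 * E) - V ^ 2 * (1 + 500 * E))) ^ 2 =
        q ^ 2 * (V ^ 4 * 500 ^ 2 * E ^ 2) := by ring
      rw [this, hq2]
      field_simp
    have h2 : (3.15 : ℝ) ^ 2 ≤ (q * (V ^ 2 * (1 + 1000 * E) - V ^ 2 * (1 + 500 * E))) ^ 2 := by
      rw [h1]
      calc (3.15 : ℝ) ^ 2 ≤ 250 * 500 ^ 2 / 1001 ^ 2 * (1 / 4) := by norm_num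
        _ ≤ _ := by gcongr
    have h3 : 0 ≤ q * (V ^ 2 * (1 + 1000 * E) - V ^ 2 * (1 + 500 * E)) := by
      apply mul_nonneg hq0.le
      nlinarith [mul_pos (pow_pos hV0 2) hE0]
    have h4 := (pow_le_pow_iff_left₀ (by norm_num) h3 two_ne_zero).1 h2
    linarith [Real.pi_lt_d2]
  · intro x hx
    have hx0 : 0 < x := lt_of_lt_of_le (by positivity) hx.1
    have hxV : x ≤ 1001 * V ^ 2 := by
      refine hx.2.trans ?_
      nlinarith [pow_pos hV0 2]
    have hfac : 4 * k * x - (a - x) ^ 2 = (x - V ^ 2) * ((A + B) ^ 2 - x) := by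
      rw [← hVa]
      have hk' : k = B ^ 2 := hB2.symm
      rw [hk', hV]
      ring
    have h1 : V ^ 2 * (500 * E) ≤ x - V ^ 2 := by linarith [hx.1]
    have h2 : 2 * (A * B) ≤ (A + B) ^ 2 - x := by
      have h3 : x ≤ V ^ 2 + 2 * (A * B) := by linarith [hx.2]
      have h4 : (A + B) ^ 2 = V ^ 2 + 4 * (A * B) := by rw [hV]; ring
      linarith
    rw [hfac, hq2]
    calc 250 * E * (A * B) / (1001 ^ 2 * V ^ 2) * (4 * x ^ 2)
        ≤ 250 * E * (A * B) / (1001 ^ 2 * V ^ 2) * (4 * (1001 * V ^ 2) ^ 2) := by gcongr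
      _ = V ^ 2 * (500 * E) * (2 * (A * B)) := by
        field_simp
        ring
      _ ≤ _ := by
        apply mul_le_mul h1 h2 (by positivity)
        have : 0 ≤ V ^ 2 * (500 * E) := by positivity
        linarith

/-- Asymptotics for the least Laguerre zero: there are absolute constants `C > 0` and `K`
such that for all `k ≥ K` and `α > 50`, the least zero `x₁` of `L_k^{(α)}` satisfies
`0 < x₁/V² − 1 ≤ C (α+1)^{−1/2} (1/(α+1) + 1/k)^{1/6}`. -/
theorem laguerre_least_zero_asymptotics :
    ∃ C : ℝ, 0 < C ∧ ∃ K : ℕ, ∀ k : ℕ, K ≤ k → ∀ α : ℝ, 50 < α →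
      ∀ x1 : ℝ, laguerre k α x1 = 0 → (∀ y : ℝ, laguerre k α y = 0 → x1 ≤ y) →
        0 < x1 / (Real.sqrt ((k : ℝ) + α + 1) - Real.sqrt (k : ℝ)) ^ 2 - 1 ∧
        x1 / (Real.sqrt ((k : ℝ) + α + 1) - Real.sqrt (k : ℝ)) ^ 2 - 1 ≤
          C * (α + 1) ^ (-(1 : ℝ) / 2) *
            (1 / (α + 1) + 1 / (k : ℝ)) ^ ((1 : ℝ) / 6) := by
  refine ⟨1000, by norm_num, 100000, ?_⟩
  intro k hk α hα x1 hz hleast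
  obtain ⟨p, hp, hode⟩ := laguerre_poly_exists k α hα
  have hkR : (100000 : ℝ) ≤ k := by exact_mod_cast hk
  have hk0 : (0 : ℝ) < k := by linarith
  have hx1 : 0 < x1 := by
    by_contra h
    push Not at h
    have := laguerre_pos_of_nonpos k α hα x1 h
    linarith
  have hne : ∀ x, x < x1 → p.eval x ≠ 0 := by
    intro x hx h0
    rw [hp] at h0
    have := hleast x h0
    linarith
  have hpos : ∀ x, x < x1 → 0 < p.eval x := by
    intro x hx
    by_contra h
    push Not at h
    have h0 : 0 < p.eval 0 := by
      rw [hp]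
      exact laguerre_pos_of_nonpos k α hα 0 le_rfl
    have hx0 : 0 < x := by
      by_contra h'
      push Not at h'
      have := laguerre_pos_of_nonpos k α hα x h'
      rw [← hp] at this
      linarith
    obtain ⟨y, hy, hy0⟩ := intermediate_value_Icc' hx0.le
      (p.continuous.continuousOn (s := Set.Icc 0 x)) ⟨h, h0.le⟩
    exact hne y (lt_of_le_of_lt hy.2 hx) hy0
  have hzero : p.eval x1 = 0 := by rw [hp, hz]
  have hassoc : (k : ℝ) + α + 1 = k + (α + 1) := by ring
  rw [hassoc]
  set a : ℝ := α + 1 with ha_def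
  have ha : 51 < a := by linarith
  set V : ℝ := Real.sqrt (k + a) - Real.sqrt k with hV
  have hA2 : Real.sqrt (k + a) ^ 2 = k + a := Real.sq_sqrt (by linarith)
  have hB2 : Real.sqrt (k : ℝ) ^ 2 = k := Real.sq_sqrt hk0.le
  have hB0 : 0 < Real.sqrt (k : ℝ) := Real.sqrt_pos.2 hk0
  have hV0 : 0 < V := sub_pos.2 (Real.sqrt_lt_sqrt hk0.le (by linarith))
  constructor
  · obtain ⟨x, hx0, hxx, hD⟩ := disc_neg_of_zero k (by omega) a x1 (by linarith) hx1 p hode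
      hpos hzero
    have hlt : V ^ 2 < x := by
      by_contra h
      push Not at h
      have hfac : (a - x) ^ 2 - 4 * k * x =
          (V ^ 2 - x) * ((Real.sqrt (k + a) + Real.sqrt k) ^ 2 - x) := by
        have e1 : a = Real.sqrt (k + a) ^ 2 - Real.sqrt k ^ 2 := by rw [hA2, hB2]; ring
        generalize Real.sqrt (k + a) = A at *
        generalize Real.sqrt (k : ℝ) = B at *
        rw [hV, e1, ← hB2]
        ring
      rw [hfac] at hD
      have h2 : V ^ 2 ≤ (Real.sqrt (k + a) + Real.sqrt k) ^ 2 := by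
        apply pow_le_pow_left₀ hV0.le
        linarith
      have := mul_nonneg (sub_nonneg.2 h) (sub_nonneg.2 (h.trans h2))
      linarith
    have : 1 < x1 / V ^ 2 := by
      rw [lt_div_iff₀ (by positivity)]
      linarith
    linarith
  · set E : ℝ := a ^ (-(1 : ℝ) / 2) * (1 / a + 1 / (k : ℝ)) ^ ((1 : ℝ) / 6) with hEdef
    have ha0 : 0 < a := by linarith
    have hs0 : 0 < 1 / a + 1 / (k : ℝ) := by positivity
    have hE0 : 0 < E := mul_pos (Real.rpow_pos_of_pos ha0 _) (Real.rpow_pos_of_pos hs0 _)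
    have hE6 : E ^ 6 = (k + a) / (k * a ^ 4) := by
      rw [hEdef, mul_pow, ← Real.rpow_natCast, ← Real.rpow_natCast, ← Real.rpow_mul ha0.le,
        ← Real.rpow_mul hs0.le]
      have e1 : (-(1 : ℝ) / 2) * ((6 : ℕ) : ℝ) = -((3 : ℕ) : ℝ) := by norm_num
      have e2 : ((1 : ℝ) / 6) * ((6 : ℕ) : ℝ) = 1 := by norm_num
      rw [e1, e2, Real.rpow_one, Real.rpow_neg ha0.le, Real.rpow_natCast]
      field_simp
    rw [mul_assoc, ← hEdef]
    by_contra hcon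
    push Not at hcon
    have hX : V ^ 2 * (1 + 1000 * E) < x1 := by
      have : 1 + 1000 * E < x1 / V ^ 2 := by linarith
      rw [lt_div_iff₀ (by positivity)] at this
      linarith
    obtain ⟨q, hq, hpi, hQ⟩ := laguerre_upper_num k a V E hkR ha hV hE0 hE6
    have := riccati_bound k a (V ^ 2 * (1 + 500 * E)) (V ^ 2 * (1 + 1000 * E)) q ha0
      (by positivity) (by nlinarith [mul_pos (pow_pos hV0 2) hE0]) hq p hode
      (fun x hx => hne x (lt_of_le_of_lt hx.2 hX)) hQ
    linarith
end

section
/- There exist absolute constants C > 0 and K such that for every integer k ≥ K and every real α > 50, the largest zero x_k of the generalized Laguerre polynomial L_k^{(α)} satisfies 0 < 1 − x_k/U² ≤ C·k^{−1/6}·(k+α)^{−1/2}, where U = √(k+α+1) + √k. -/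
noncomputable def lagB (α : ℝ) (i : ℕ) : ℝ := (i : ℝ) * Real.sqrt (((i : ℝ) + α) / i)

noncomputable def lagW (α : ℝ) : ℕ → ℝ
  | 0 => 1
  | (i + 1) => lagW α i * Real.sqrt (((i + 1 : ℕ) + α) / (i + 1 : ℕ))

lemma lagW_pos {α : ℝ} (hα : 0 < α) : ∀ i, 0 < lagW α i
  | 0 => by simp [lagW]
  | (i + 1) => by
    have := lagW_pos hα i
    rw [lagW]
    positivity

lemma lagB_eq {α : ℝ} (i : ℕ) : lagB α i = Real.sqrt (i * (i + α)) := by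
  unfold lagB
  rcases Nat.eq_zero_or_pos i with h | h
  · simp [h]
  · have hi : (0 : ℝ) < i := by exact_mod_cast h
    rw [show (i : ℝ) * (i + α) = i ^ 2 * ((i + α) / i) by field_simp,
      Real.sqrt_mul (by positivity), Real.sqrt_sq hi.le]

lemma lagB_mono {α : ℝ} (hα : 0 < α) {i j : ℕ} (h : i ≤ j) : lagB α i ≤ lagB α j := by
  have : (i : ℝ) ≤ j := by exact_mod_cast h
  rw [lagB_eq, lagB_eq]
  apply Real.sqrt_le_sqrt
  gcongr

lemma lagB_pos {α : ℝ} (hα : 0 < α) (i : ℕ) : 0 < lagB α (i + 1) := by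
  unfold lagB; positivity

noncomputable def lagc (k : ℕ) (α : ℝ) (i : ℕ) : ℝ :=
  if i ≤ k then ((-1 : ℝ) ^ i / (Nat.factorial i)) *
      ((∏ j ∈ Finset.range (k - i), (α + (i : ℝ) + (j : ℝ) + 1)) /
        (Nat.factorial (k - i))) else 0

lemma laguerre_eq (k : ℕ) (α x : ℝ) (N : ℕ) (h : k < N) :
    laguerre k α x = ∑ i ∈ Finset.range N, lagc k α i * x ^ i := by
  unfold laguerre
  rw [← Finset.sum_subset (Finset.range_subset_range.2 (show k + 1 ≤ N by omega))]
  · apply Finset.sum_congr rfl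
    intro i hi
    have : i ≤ k := by simp at hi; omega
    simp [lagc, this]
  · intro i _ hi
    have : ¬ i ≤ k := by simp at hi; omega
    simp [lagc, this]

lemma lagc_rec (k : ℕ) (α : ℝ) (i : ℕ) :
    ((k : ℝ) + 2) * lagc (k + 2) α (i + 1) = (2 * k + 3 + α) * lagc (k + 1) α (i + 1)
      - lagc (k + 1) α i - (k + 1 + α) * lagc k α (i + 1) := by
  have hf : ((Nat.factorial i : ℕ) : ℝ) ≠ 0 := by positivity
  rcases lt_or_ge k i with h | h
  · rcases Nat.lt_or_ge i (k + 2) with h2 | h2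
    · have : i = k + 1 := by omega
      subst this
      simp [lagc, Nat.factorial_succ, pow_succ]
      field_simp
      push_cast
      ring
    · simp [lagc, show ¬ i ≤ k by omega, show ¬ i ≤ k + 1 by omega, show ¬ i + 1 ≤ k by omega]
  · rcases Nat.eq_or_lt_of_le h with h | h
    · subst h
      simp [lagc, Nat.factorial_succ, pow_succ, show i + 2 - (i + 1) = 1 by omega]
      field_simp
      push_cast
      ring
    · obtain ⟨m, rfl⟩ : ∃ m, k = i + 1 + m := ⟨k - (i + 1), by omega⟩
      have hm : ((Nat.factorial m : ℕ) : ℝ) ≠ 0 := by positivity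
      simp only [lagc, show i + 1 ≤ i + 1 + m + 2 by omega, show i + 1 ≤ i + 1 + m + 1 by omega,
        show i ≤ i + 1 + m + 1 by omega, show i + 1 ≤ i + 1 + m by omega, if_true,
        show i + 1 + m + 2 - (i + 1) = m + 2 by omega,
        show i + 1 + m + 1 - (i + 1) = m + 1 by omega,
        show i + 1 + m + 1 - i = m + 2 by omega,
        show i + 1 + m - (i + 1) = m by omega]
      rw [Finset.prod_range_succ' (fun j : ℕ => α + (i : ℝ) + (j : ℝ) + 1) (m + 1)]
      have hc : ∀ j : ℕ, α + (i : ℝ) + ((j + 1 : ℕ) : ℝ) + 1 = α + ((i + 1 : ℕ) : ℝ) + j + 1 := by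
        intro j; push_cast; ring
      simp only [hc]
      simp only [Finset.prod_range_succ, Nat.factorial_succ, pow_succ]
      generalize (∏ j ∈ Finset.range m, (α + ((i + 1 : ℕ) : ℝ) + (j : ℝ) + 1)) = P
      push_cast
      field_simp
      ring

lemma lagc_rec0 (k : ℕ) (α : ℝ) :
    ((k : ℝ) + 2) * lagc (k + 2) α 0 = (2 * k + 3 + α) * lagc (k + 1) α 0
      - (k + 1 + α) * lagc k α 0 := by
  have hm : ((Nat.factorial k : ℕ) : ℝ) ≠ 0 := by positivity
  simp only [lagc, Nat.zero_le, if_true, Nat.sub_zero, Finset.prod_range_succ, Nat.factorial_succ]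
  push_cast
  field_simp
  ring

lemma laguerre_rec (k : ℕ) (α x : ℝ) :
    ((k : ℝ) + 2) * laguerre (k + 2) α x = (2 * k + 3 + α - x) * laguerre (k + 1) α x
      - (k + 1 + α) * laguerre k α x := by
  have hx : x * laguerre (k + 1) α x =
      ∑ i ∈ Finset.range (k + 3), lagc (k + 1) α i * x ^ (i + 1) := by
    rw [laguerre_eq (k + 1) α x (k + 3) (by omega), Finset.mul_sum]
    exact Finset.sum_congr rfl fun i _ => by ring
  rw [sub_mul, hx, laguerre_eq (k + 2) α x (k + 3 + 1) (by omega),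
    laguerre_eq (k + 1) α x (k + 3 + 1) (by omega), laguerre_eq k α x (k + 3 + 1) (by omega)]
  rw [Finset.sum_range_succ', Finset.sum_range_succ' _ (k + 3), Finset.sum_range_succ' _ (k + 3)]
  simp only [mul_add, Finset.mul_sum]
  have h0 := lagc_rec0 k α
  have hs : ∑ i ∈ Finset.range (k + 3), ((k : ℝ) + 2) * (lagc (k + 2) α (i + 1) * x ^ (i + 1))
    = ∑ i ∈ Finset.range (k + 3), (2 * k + 3 + α) * (lagc (k + 1) α (i + 1) * x ^ (i + 1))
      - ∑ i ∈ Finset.range (k + 3), lagc (k + 1) α i * x ^ (i + 1)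
      - ∑ i ∈ Finset.range (k + 3), (k + 1 + α) * (lagc k α (i + 1) * x ^ (i + 1)) := by
    rw [← Finset.sum_sub_distrib, ← Finset.sum_sub_distrib]
    refine Finset.sum_congr rfl fun i _ => ?_
    linear_combination x ^ (i + 1) * lagc_rec k α i
  rw [hs]
  simp only [pow_zero]
  linear_combination h0

/-- normalized values -/
noncomputable def lagP (α x : ℝ) (i : ℕ) : ℝ := (-1) ^ i * laguerre i α x / lagW α i

lemma lagP_zero (α x : ℝ) : lagP α x 0 = 1 := by
  simp [lagP, lagW, laguerre]

lemma lagP_rec {α : ℝ} (hα : 0 < α) (x : ℝ) (i : ℕ) :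
    lagB α (i + 1) * lagP α x (i + 1) =
      (x - (2 * i + 1 + α)) * lagP α x i - lagB α i * lagP α x (i - 1) := by
  rcases i with _ | i
  · have h : 0 < Real.sqrt (1 + α) := by positivity
    simp [lagP, lagW, laguerre, lagB, Finset.sum_range_succ]
    field_simp
    ring
  · have hr := laguerre_rec i α x
    have hw := lagW_pos hα i
    simp only [lagP, Nat.add_sub_cancel, lagB, lagW]
    have h1 : 0 < Real.sqrt (((i + 1 : ℕ) + α) / (i + 1 : ℕ)) := by positivity
    have h2 : 0 < Real.sqrt (((i + 1 + 1 : ℕ) + α) / (i + 1 + 1 : ℕ)) := by positivity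
    have h3 : Real.sqrt (((i + 1 : ℕ) + α) / (i + 1 : ℕ)) ^ 2 = ((i + 1 : ℕ) + α) / (i + 1 : ℕ) :=
      Real.sq_sqrt (by positivity)
    generalize Real.sqrt (((i + 1 : ℕ) + α) / (i + 1 : ℕ)) = r at *
    generalize Real.sqrt (((i + 1 + 1 : ℕ) + α) / (i + 1 + 1 : ℕ)) = s at *
    have h4 : ((i : ℝ) + 1) * r ^ 2 = i + 1 + α := by
      rw [h3]; push_cast; field_simp
    field_simp
    push_cast
    ring_nf at hr h4 ⊢
    linear_combination (-1) ^ i * hr + (-1) ^ i * laguerre i α x * h4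

lemma lagP_pos {α x : ℝ} (hα : 0 < α) (k : ℕ) (hx : 2 * k + α + 2 * lagB α k ≤ x) :
    ∀ i, i ≤ k → 0 < lagP α x i ∧ (i + 1 ≤ k → lagP α x i ≤ lagP α x (i + 1)) := by
  have key : ∀ i, i + 1 ≤ k → lagB α i + lagB α (i + 1) ≤ x - (2 * i + 1 + α) := by
    intro i hi
    have h1 := lagB_mono hα (show i ≤ k by omega)
    have h2 := lagB_mono hα hi
    have : (i : ℝ) + 1 ≤ k := by exact_mod_cast hi
    linarith
  have fin : ∀ i, i + 1 ≤ k → 0 < lagP α x i → lagB α i * lagP α x (i - 1) ≤ lagB α i * lagP α x i →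
      lagP α x i ≤ lagP α x (i + 1) := by
    intro i hi h0 h1
    have hr := lagP_rec hα x i
    have hb := lagB_pos hα i
    have := mul_le_mul_of_nonneg_right (key i hi) h0.le
    refine le_of_mul_le_mul_left (a := lagB α (i + 1)) ?_ hb
    nlinarith
  intro i
  induction i with
  | zero =>
    intro _
    have h0 : 0 < lagP α x 0 := by simp [lagP_zero]
    exact ⟨h0, fun h => fin 0 h h0 le_rfl⟩
  | succ i ih =>
    intro hi
    obtain ⟨a, b⟩ := ih (by omega)
    have c := b hi
    have h0 : 0 < lagP α x (i + 1) := by linarith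
    exact ⟨h0, fun h => fin (i + 1) h h0 (mul_le_mul_of_nonneg_left c (lagB_pos hα i).le)⟩

/-- entries of the Jacobi matrix -/
noncomputable def lagJ (α : ℝ) (i j : ℕ) : ℝ :=
  (if j = i then 2 * (i : ℝ) + 1 + α else 0) + (if j + 1 = i then lagB α i else 0) +
    (if j = i + 1 then lagB α (i + 1) else 0)

lemma lagJ_symm (α : ℝ) (i j : ℕ) : lagJ α i j = lagJ α j i := by
  unfold lagJ
  rcases lt_trichotomy i j with h | h | h
  · by_cases h' : j = i + 1
    · subst h'; simp [show ∀ a : ℕ, ¬ a + 1 + 1 = a by omega, show ∀ a : ℕ, ¬ a = a + 1 + 1 by omega]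
    · simp [show j ≠ i by omega, show i ≠ j by omega, h', show j + 1 ≠ i by omega,
        show i + 1 ≠ j by omega, show i ≠ j + 1 by omega]
  · subst h; rfl
  · by_cases h' : i = j + 1
    · subst h'; simp [show ∀ a : ℕ, ¬ a + 1 + 1 = a by omega, show ∀ a : ℕ, ¬ a = a + 1 + 1 by omega]
    · simp [show j ≠ i by omega, show i ≠ j by omega, h', show j + 1 ≠ i by omega,
        show i + 1 ≠ j by omega, show j ≠ i + 1 by omega]

lemma lagJ_sum (α : ℝ) (k : ℕ) (f : ℕ → ℝ) (hf : f k = 0) (i : ℕ) (hi : i < k) :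
    ∑ j ∈ Finset.range k, lagJ α i j * f j =
      (2 * (i : ℝ) + 1 + α) * f i + lagB α i * f (i - 1) + lagB α (i + 1) * f (i + 1) := by
  simp only [lagJ, add_mul, Finset.sum_add_distrib, ite_mul, zero_mul]
  congr 1
  · congr 1
    · rw [Finset.sum_ite_eq' (Finset.range k) i]; simp [hi]
    · rcases i with _ | i
      · simp [lagB]
      · simp only [Nat.add_right_cancel_iff, Nat.add_sub_cancel]
        rw [Finset.sum_ite_eq' (Finset.range k) i]; simp [show i < k by omega]
  · rw [Finset.sum_ite_eq' (Finset.range k) (i + 1)]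
    by_cases h : i + 1 < k
    · simp [h]
    · have : i + 1 = k := by omega
      simp [this, hf]

lemma lag_eig {α : ℝ} (hα : 0 < α) (k : ℕ) (hk : 0 < k) (x : ℝ) (f : ℕ → ℝ) (hf : f k = 0)
    (h : ∀ i, i < k → ∑ j ∈ Finset.range k, lagJ α i j * f j = x * f i)
    (hne : ∃ i, i < k ∧ f i ≠ 0) : laguerre k α x = 0 := by
  have main : ∀ i, i ≤ k → f i = f 0 * lagP α x i := by
    intro i
    induction i using Nat.strong_induction_on with
    | _ i ih =>
      intro hi
      rcases i with _ | i
      · simp [lagP_zero]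
      · have e := h i (by omega)
        rw [lagJ_sum α k f hf i (by omega), ih i (by omega) (by omega),
          ih (i - 1) (by omega) (by omega)] at e
        have hr := lagP_rec hα x i
        have hb := (lagB_pos hα i).ne'
        apply mul_left_cancel₀ hb
        linear_combination e - f 0 * hr
  obtain ⟨i, hi, hne⟩ := hne
  have h0 : f 0 ≠ 0 := by
    intro h0
    apply hne
    rw [main i hi.le, h0, zero_mul]
  have := main k le_rfl
  rw [hf] at this
  have hp : lagP α x k = 0 := by
    rcases mul_eq_zero.1 this.symm with h | h
    · exact absurd h h0
    · exact h
  have hw := (lagW_pos hα k).ne'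
  simpa [lagP, hw] using hp

lemma lag_rayleigh {α : ℝ} (hα : 0 < α) (k : ℕ) (hk : 0 < k) (xk : ℝ)
    (hmax : ∀ y, laguerre k α y = 0 → y ≤ xk) (f : ℕ → ℝ) :
    ∑ i ∈ Finset.range k, f i * ∑ j ∈ Finset.range k, lagJ α i j * f j ≤
      xk * ∑ i ∈ Finset.range k, f i ^ 2 := by
  classical
  let J : Matrix (Fin k) (Fin k) ℝ := Matrix.of fun i j => lagJ α i j
  let A : Matrix (Fin k) (Fin k) ℝ := xk • (1 : Matrix (Fin k) (Fin k) ℝ) - J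
  have hA : A.IsHermitian := by
    ext i j
    simp [A, J, Matrix.one_apply, lagJ_symm α i j, eq_comm]
  have hmul : ∀ v : Fin k → ℝ, A.mulVec v = fun i => xk * v i - ∑ j : Fin k, lagJ α i j * v j := by
    intro v
    ext i
    simp only [A, Matrix.sub_mulVec, Matrix.smul_mulVec, Matrix.one_mulVec, Pi.sub_apply,
      Pi.smul_apply, smul_eq_mul]
    rfl
  have hpos : A.PosSemidef := by
    rw [hA.posSemidef_iff_eigenvalues_nonneg]
    intro s
    show 0 ≤ hA.eigenvalues s
    have he := hA.mulVec_eigenvectorBasis s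
    have hv0 : (hA.eigenvectorBasis s) ≠ 0 := hA.eigenvectorBasis.orthonormal.ne_zero s
    set μ := hA.eigenvalues s
    set v : Fin k → ℝ := ⇑(hA.eigenvectorBasis s) with hv
    have hv0' : ∃ i, v i ≠ 0 := by
      by_contra! hcon
      apply hv0
      ext i
      exact hcon i
    rw [hmul] at he
    let g : ℕ → ℝ := fun i => if h : i < k then v ⟨i, h⟩ else 0
    have hg : ∀ i : Fin k, g i = v i := fun i => by simp [g]
    have := hmax (xk - μ) (lag_eig hα k hk (xk - μ) g (by simp [g]) ?_ ?_)
    · linarith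
    · intro i hi
      have e := congrFun he ⟨i, hi⟩
      simp only [Pi.smul_apply, smul_eq_mul] at e
      rw [Finset.sum_range, show g i = v ⟨i, hi⟩ from hg ⟨i, hi⟩]
      simp only [hg]
      linarith
    · obtain ⟨i, hi⟩ := hv0'
      exact ⟨i, i.2, by rwa [hg]⟩
  have := hpos.dotProduct_mulVec_nonneg (fun i : Fin k => f i)
  rw [hmul] at this
  simp only [dotProduct, Pi.star_apply, star_trivial, mul_sub, Finset.sum_sub_distrib] at this
  simp only [Finset.sum_range]
  have e : ∑ i : Fin k, f i * (xk * f i) = xk * ∑ i : Fin k, f i ^ 2 := by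
    rw [Finset.mul_sum]; exact Finset.sum_congr rfl fun i _ => by ring
  linarith

lemma sum1 (M : ℝ) (m : ℕ) : ∑ t ∈ Finset.range m, ((t : ℝ) * (M - t)) =
    M * (m * (m - 1) / 2) - (m - 1) * m * (2 * m - 1) / 6 := by
  induction m with
  | zero => simp
  | succ n ih => rw [Finset.sum_range_succ, ih]; push_cast; ring

lemma sum2 (M : ℝ) (m : ℕ) : ∑ t ∈ Finset.range m, ((t : ℝ) * (M - t)) ^ 2 =
    M ^ 2 * ((m - 1) * m * (2 * m - 1) / 6) - 2 * M * (m * (m - 1) / 2) ^ 2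
      + (m - 1) * m * (2 * m - 1) * (3 * m ^ 2 - 3 * m - 1) / 30 := by
  induction m with
  | zero => simp
  | succ n ih => rw [Finset.sum_range_succ, ih]; push_cast; ring

lemma lag_lower {α : ℝ} (hα : 0 < α) (n m : ℕ) (hm : 2 ≤ m) (xk : ℝ)
    (hmax : ∀ y, laguerre (n + m) α y = 0 → y ≤ xk) :
    2 * n + 1 + α + 2 * lagB α n - 10 * lagB α n / (m ^ 2 + 1) ≤ xk := by
  have hm' : (2 : ℝ) ≤ m := by exact_mod_cast hm
  let f : ℕ → ℝ := fun i => if n ≤ i then ((i : ℝ) - n) * (n + m - i) else 0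
  have hfn : ∀ t : ℕ, f (n + t) = (t : ℝ) * (m - t) := by
    intro t; simp [f]
  have hR := lag_rayleigh hα (n + m) (by omega) xk hmax f
  have hlow : ∀ i ∈ Finset.range (n + m), (2 * n + 1 + α + 2 * lagB α n) * f i ^ 2
      - 2 * lagB α n * f i ≤ f i * ∑ j ∈ Finset.range (n + m), lagJ α i j * f j := by
    intro i hi
    have hi := Finset.mem_range.1 hi
    rw [lagJ_sum α (n + m) f (by rw [hfn]; simp) i hi]
    rcases le_or_gt i n with h | h
    · have : f i = 0 := by
        rcases Nat.eq_or_lt_of_le h with h | h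
        · simp [f, h]
        · simp [f, show ¬ n ≤ i by omega]
      simp [this]
    · obtain ⟨t, rfl⟩ : ∃ t, i = n + (t + 1) := ⟨i - n - 1, by omega⟩
      rw [show n + (t + 1) - 1 = n + t by omega, show n + (t + 1) + 1 = n + (t + 2) by omega,
        hfn, hfn, hfn]
      have h1 := lagB_mono hα (show n ≤ n + (t + 1) by omega)
      have h2 := lagB_mono hα (show n ≤ n + (t + 2) by omega)
      have ht : (t : ℝ) + 2 ≤ m := by
        have : t + 2 ≤ m := by omega
        exact_mod_cast this
      have ht0 : (0 : ℝ) ≤ t := by positivity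
      push_cast
      have a0 : 0 ≤ (t : ℝ) * (m - t) := mul_nonneg ht0 (by linarith)
      have a1 : 0 ≤ ((t : ℝ) + 1) * (m - (t + 1)) := mul_nonneg (by linarith) (by linarith)
      have a2 : 0 ≤ ((t : ℝ) + 2) * (m - (t + 2)) := mul_nonneg (by linarith) (by linarith)
      have e : (t : ℝ) * (m - t) + ((t : ℝ) + 2) * (m - (t + 2)) =
        2 * (((t : ℝ) + 1) * (m - (t + 1))) - 2 := by ring
      have c0 := mul_le_mul_of_nonneg_right h1 a0
      have c2 := mul_le_mul_of_nonneg_right h2 a2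
      have c1 : (2 * (n : ℝ) + 1 + α) * (((t : ℝ) + 1) * (m - (t + 1))) ≤
        (2 * (n + (t + 1)) + 1 + α) * (((t : ℝ) + 1) * (m - (t + 1))) :=
        mul_le_mul_of_nonneg_right (by linarith) a1
      have := mul_le_mul_of_nonneg_left (add_le_add (add_le_add c1 c0) c2) a1
      refine le_trans (le_of_eq ?_) this
      linear_combination -(((t : ℝ) + 1) * (m - (t + 1))) * lagB α n * e
  have hs := (Finset.sum_le_sum hlow).trans hR
  rw [Finset.sum_sub_distrib, ← Finset.mul_sum, ← Finset.mul_sum] at hs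
  have hz : ∀ i ∈ Finset.range n, f i = 0 := by
    intro i hi
    have := Finset.mem_range.1 hi
    simp [f, show ¬ n ≤ i by omega]
  have e1 : ∑ i ∈ Finset.range (n + m), f i = (m ^ 3 - m) / 6 := by
    rw [Finset.sum_range_add, Finset.sum_eq_zero hz]
    simp only [hfn]
    rw [sum1]; ring
  have e2 : ∑ i ∈ Finset.range (n + m), f i ^ 2 = (m ^ 5 - m) / 30 := by
    rw [Finset.sum_range_add, Finset.sum_eq_zero (fun i hi => by rw [hz i hi]; simp)]
    simp only [hfn]
    rw [sum2]; ring
  rw [e1, e2] at hs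
  have hS : (0 : ℝ) < (m ^ 5 - m) / 30 := by
    have : (m : ℝ) ^ 5 - m = m * (m ^ 2 - 1) * (m ^ 2 + 1) := by ring
    rw [this]
    have : (0 : ℝ) < m ^ 2 - 1 := by nlinarith
    positivity
  refine le_of_mul_le_mul_right ?_ hS
  refine le_trans (le_of_eq ?_) hs
  have : (m : ℝ) ^ 2 + 1 ≠ 0 := by positivity
  field_simp
  ring

set_option maxHeartbeats 1000000 in
/-- Asymptotics for the largest Laguerre zero: there are absolute constants `C > 0` and `K`
such that for all `k ≥ K` and `α > 50`, the largest zero `x_k` of `L_k^{(α)}` satisfies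
`0 < 1 − x_k/U² ≤ C k^{−1/6} (k+α)^{−1/2}`. -/
theorem laguerre_largest_zero_asymptotics :
    ∃ C : ℝ, 0 < C ∧ ∃ K : ℕ, ∀ k : ℕ, K ≤ k → ∀ α : ℝ, 50 < α →
      ∀ xk : ℝ, laguerre k α xk = 0 → (∀ y : ℝ, laguerre k α y = 0 → y ≤ xk) →
        0 < 1 - xk / (Real.sqrt ((k : ℝ) + α + 1) + Real.sqrt (k : ℝ)) ^ 2 ∧
        1 - xk / (Real.sqrt ((k : ℝ) + α + 1) + Real.sqrt (k : ℝ)) ^ 2 ≤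
          C * (k : ℝ) ^ (-(1 : ℝ) / 6) * ((k : ℝ) + α) ^ (-(1 : ℝ) / 2) := by
  refine ⟨26, by norm_num, 8, ?_⟩
  intro k hk α hα50 xk hzero hmax
  have hα : 0 < α := by linarith
  have hkR : (8 : ℝ) ≤ k := by exact_mod_cast hk
  have hk0 : (0 : ℝ) < k := by linarith
  have hU : (Real.sqrt ((k : ℝ) + α + 1) + Real.sqrt (k : ℝ)) ^ 2 =
      2 * k + α + 1 + 2 * Real.sqrt (k * (k + α + 1)) := by
    rw [add_sq, Real.sq_sqrt (by positivity), Real.sq_sqrt hk0.le, Real.sqrt_mul hk0.le]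
    ring
  rw [hU]
  set R := Real.sqrt (k * (k + α + 1)) with hR
  have hR0 : 0 ≤ R := Real.sqrt_nonneg _
  have hUpos : 0 < 2 * k + α + 1 + 2 * R := by positivity
  constructor
  · rw [sub_pos, div_lt_one hUpos]
    by_contra! hcon
    have hB : lagB α k ≤ R := by
      rw [lagB_eq, hR]
      apply Real.sqrt_le_sqrt
      exact mul_le_mul_of_nonneg_left (by linarith) hk0.le
    have := (lagP_pos hα k (x := xk) (by linarith) k le_rfl).1
    simp [lagP, hzero] at this
  · -- choose the window
    set c : ℝ := (k : ℝ) ^ ((1 : ℝ) / 3) with hc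
    have hc3 : c ^ 3 = k := by
      rw [hc, ← Real.rpow_natCast, ← Real.rpow_mul hk0.le]; norm_num
    have hc0 : 0 < c := by positivity
    have hc2 : 2 ≤ c := by
      by_contra! h
      have : c ^ 3 < 2 ^ 3 := by gcongr
      linarith
    obtain ⟨m, hm⟩ : ∃ m : ℕ, m = ⌈c⌉₊ := ⟨_, rfl⟩
    have hm1 : c ≤ m := by rw [hm]; exact Nat.le_ceil c
    have hm2 : (m : ℝ) ≤ 2 * c := by
      have := Nat.ceil_lt_add_one hc0.le
      rw [hm]; linarith
    have hmk : m ≤ k := by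
      have : (m : ℝ) ≤ k := by
        have h4 : 4 * c ≤ c ^ 3 := by nlinarith [mul_pos hc0 hc0]
        linarith
      exact_mod_cast this
    have hm2' : 2 ≤ m := by
      have : (2 : ℝ) ≤ m := by linarith
      exact_mod_cast this
    obtain ⟨n, rfl⟩ : ∃ n, k = n + m := ⟨k - m, by omega⟩
    have hlow := lag_lower hα n m hm2' xk hmax
    have hnk : ((n + m : ℕ) : ℝ) = n + m := by push_cast; ring
    have hn0 : (0 : ℝ) ≤ n := by positivity
    have hm0 : (0 : ℝ) < m := by linarith
    have hB0 : 0 ≤ lagB α n := by unfold lagB; positivity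
    have hBsq : lagB α n ^ 2 = n * (n + α) := by rw [lagB_eq, Real.sq_sqrt (by positivity)]
    have hRsq : R ^ 2 = ((n + m : ℕ) : ℝ) * ((n + m : ℕ) + α + 1) := by
      rw [hR, Real.sq_sqrt (by positivity)]
    -- notation
    set κ : ℝ := ((n + m : ℕ) : ℝ) with hκ
    set s : ℝ := Real.sqrt (κ + α) with hs
    set r : ℝ := Real.sqrt κ with hr
    have hs0 : 0 < s := by positivity
    have hr0 : 0 < r := by positivity
    have hs2 : s ^ 2 = κ + α := Real.sq_sqrt (by positivity)
    have hr2 : r ^ 2 = κ := Real.sq_sqrt (by positivity)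
    have hrs : r ≤ s := Real.sqrt_le_sqrt (by linarith)
    have hrsR : r * s ≤ R := by
      refine abs_le_of_sq_le_sq' ?_ hR0 |>.2
      rw [mul_pow, hr2, hs2, hRsq]
      nlinarith
    have hBrs : lagB α n ≤ r * s := by
      refine abs_le_of_sq_le_sq' ?_ (by positivity) |>.2
      rw [mul_pow, hr2, hs2, hBsq, hnk]
      gcongr <;> linarith
    -- difference of square roots
    have hdiff : R - lagB α n ≤ 3 * m * (s / r) := by
      have h1 : (R - lagB α n) * (R + lagB α n) ≤ 3 * m * s ^ 2 := by
        have : (R - lagB α n) * (R + lagB α n) = R ^ 2 - lagB α n ^ 2 := by ring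
        rw [this, hRsq, hBsq, hs2, hnk]
        have : (2 : ℝ) ≤ m := by linarith
        nlinarith [mul_nonneg hn0 hm0.le, mul_nonneg hα.le hm0.le]
      have h2 : 0 ≤ R - lagB α n := by linarith
      have h3 : (R - lagB α n) * (r * s) ≤ 3 * m * s ^ 2 :=
        le_trans (mul_le_mul_of_nonneg_left (by linarith) h2) h1
      have h4 : 0 < r * s := by positivity
      refine le_of_mul_le_mul_right (h3.trans (le_of_eq ?_)) h4
      field_simp
    have hone : 1 ≤ s / r := (one_le_div hr0).2 hrs
    have hfrac : 10 * lagB α n / (m ^ 2 + 1) ≤ 10 * (r * s) / c ^ 2 := by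
      apply div_le_div₀ (by positivity) (by linarith) (by positivity)
      have : c ^ 2 ≤ (m : ℝ) ^ 2 := by gcongr
      linarith
    have htot : 2 * κ + α + 1 + 2 * R - xk ≤ 16 * c * (s / r) + 10 * (r * s) / c ^ 2 := by
      have : 2 * (m : ℝ) ≤ 2 * m * (s / r) := le_mul_of_one_le_right (by positivity) hone
      have h8 : 8 * (m : ℝ) * (s / r) ≤ 16 * c * (s / r) :=
        mul_le_mul_of_nonneg_right (by linarith) (by positivity)
      linarith
    have hpow1 : κ ^ (-(1 : ℝ) / 6) = c / r := by
      rw [hc, hr, Real.sqrt_eq_rpow, ← Real.rpow_sub hk0]; norm_num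
    have hpow2 : (κ + α) ^ (-(1 : ℝ) / 2) = 1 / s := by
      rw [hs, Real.sqrt_eq_rpow, neg_div, Real.rpow_neg (by positivity), one_div ((κ + α) ^ _)]
    have hrc : r / c ^ 2 = c / r := by
      field_simp
      rw [hr2, ← hc3]
    have htot2 : 2 * κ + α + 1 + 2 * R - xk ≤ 26 * (c / r) * s := by
      have e : 10 * (r * s) / c ^ 2 = 10 * (r / c ^ 2) * s := by ring
      rw [e, hrc] at htot
      refine htot.trans (le_of_eq ?_)
      ring
    rw [hpow1, hpow2]
    have e : 1 - xk / (2 * κ + α + 1 + 2 * R) =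
        (2 * κ + α + 1 + 2 * R - xk) / (2 * κ + α + 1 + 2 * R) := by
      field_simp
    rw [e, div_le_iff₀ hUpos]
    refine htot2.trans ?_
    have : s ≤ 1 / s * (2 * κ + α + 1 + 2 * R) := by
      rw [one_div, ← div_eq_inv_mul, le_div_iff₀ hs0, ← sq, hs2]
      linarith
    calc 26 * (c / r) * s ≤ 26 * (c / r) * (1 / s * (2 * κ + α + 1 + 2 * R)) := by gcongr
      _ = _ := by ring
end
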